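/- arXiv:math/9801072 — 3 statements merged into one kernel-verified Lean document; each statement's English description precedes it below -/
import Mathlib

section
/- For every integer N ≥ 2 and every z in the upper half-plane, E(z,N) = ((N−1)/3)π² + 8π² Σ_{n≥1} ( Σ_{d|n, d>0, d ≢ 0 (mod N)} d ) e^{2πinz}. -/
open Complex Filter UpperHalfPlane
open scoped MatrixGroups

noncomputable section

/-- `G₂*(z) = 2ζ(2) + 2 Σ_{m≥1} Σ_{n∈ℤ} (mz+n)⁻²`. -/
def G2star (z : ℂ) : ℂ :=
  2 * riemannZeta 2 + 2 * ∑' m : ℕ+, ∑' n : ℤ, ((m : ℂ) * z + (n : ℂ)) ^ (-2 : ℤ)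

/-- `E(z,N) = N·G₂*(Nz) − G₂*(z)`. -/
def Efun (z : ℂ) (N : ℕ) : ℂ := (N : ℂ) * G2star ((N : ℂ) * z) - G2star z

theorem summable_sigma_one_mul_cexp_pow (z : ℍ) :
    Summable fun n : ℕ+ =>
      (ArithmeticFunction.sigma 1 n : ℂ) * cexp (2 * Real.pi * Complex.I * z) ^ (n : ℕ) :=
  (EisensteinSeries.summable_sigma_mul_cexp_pow (k := 2) one_le_two z).comp_injective
    PNat.coe_injective

theorem tsum_add_int_zpow_neg_two (w : ℍ) :
    ∑' n : ℤ, ((w : ℂ) + n) ^ (-2 : ℤ) =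
      -4 * (Real.pi : ℂ) ^ 2 *
        ∑' n : ℕ+, (n : ℂ) * cexp (2 * Real.pi * Complex.I * w) ^ (n : ℕ) := by
  have h := EisensteinSeries.qExpansion_identity_pnat (k := 1) le_rfl w
  have hc : ((-2 * Real.pi * Complex.I : ℂ)) ^ 2 = -4 * (Real.pi : ℂ) ^ 2 := by
    rw [mul_pow, I_sq]
    ring
  simp only [Nat.reduceAdd, pow_one, Nat.factorial_one, Nat.cast_one, div_one, hc] at h
  rw [← h]
  refine tsum_congr fun n => ?_
  rw [zpow_neg, one_div]
  norm_cast

theorem G2star_eq_tsum_sigma (z : ℍ) :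
    G2star z = (Real.pi : ℂ) ^ 2 / 3 -
      8 * (Real.pi : ℂ) ^ 2 *
        ∑' n : ℕ+, (ArithmeticFunction.sigma 1 n : ℂ) *
          cexp (2 * Real.pi * Complex.I * z) ^ (n : ℕ) := by
  have hm (m : ℕ+) : ∑' n : ℤ, ((m : ℂ) * z + n) ^ (-2 : ℤ) =
      -4 * (Real.pi : ℂ) ^ 2 *
        ∑' n : ℕ+, (n : ℂ) ^ 1 * cexp (2 * Real.pi * Complex.I * z) ^ (m * n : ℕ) := by
    have h := tsum_add_int_zpow_neg_two ⟨m * z, by simpa using z.2⟩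
    simp only at h
    rw [h]
    congr 1
    refine tsum_congr fun n => ?_
    rw [pow_one, pow_mul, ← Complex.exp_nat_mul _ (m : ℕ)]
    congr 3
    ring
  rw [G2star, tsum_congr hm, tsum_mul_left,
    tsum_prod_pow_eq_tsum_sigma 1 (norm_exp_two_pi_I_lt_one z), riemannZeta_two]
  ring

theorem sum_divisors_filter_dvd_mul {N : ℕ} (hN : N ≠ 0) (k : ℕ) :
    ∑ d ∈ (N * k).divisors.filter (N ∣ ·), d = N * ArithmeticFunction.sigma 1 k := by
  have h : (N * k).divisors.filter (N ∣ ·) = k.divisors.image (N * ·) := by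
    ext d
    simp only [Finset.mem_filter, Nat.mem_divisors, Finset.mem_image]
    constructor
    · rintro ⟨⟨hd, h0⟩, e, rfl⟩
      exact ⟨e, ⟨(Nat.mul_dvd_mul_iff_left (Nat.pos_of_ne_zero hN)).1 hd,
        right_ne_zero_of_mul h0⟩, rfl⟩
    · rintro ⟨e, ⟨he, h0⟩, rfl⟩
      exact ⟨⟨mul_dvd_mul_left N he, mul_ne_zero hN h0⟩, dvd_mul_right N e⟩
  rw [h, Finset.sum_image fun a _ b _ hab => Nat.eq_of_mul_eq_mul_left
    (Nat.pos_of_ne_zero hN) hab, ← Finset.mul_sum, ArithmeticFunction.sigma_one_apply]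

theorem hasSum_divisors_filter_dvd_mul_cexp {N : ℕ} (hN : 0 < N) (z w : ℍ)
    (hw : (w : ℂ) = N * z) :
    HasSum (fun n : ℕ+ => (∑ d ∈ (n : ℕ).divisors.filter (N ∣ ·), (d : ℂ)) *
        cexp (2 * Real.pi * Complex.I * z) ^ (n : ℕ))
      (N * ∑' n : ℕ+, (ArithmeticFunction.sigma 1 n : ℂ) *
        cexp (2 * Real.pi * Complex.I * w) ^ (n : ℕ)) := by
  have hinj : Function.Injective fun k : ℕ+ => N.toPNat hN * k := mul_right_injective _
  rw [← hinj.hasSum_iff]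
  · refine ((summable_sigma_one_mul_cexp_pow w).hasSum.mul_left (N : ℂ)).congr_fun fun k => ?_
    have h := congrArg (Nat.cast : ℕ → ℂ) (sum_divisors_filter_dvd_mul hN.ne' k)
    push_cast at h
    have hk : ((N.toPNat hN * k : ℕ+) : ℕ) = N * k := rfl
    rw [Function.comp_apply, hk, h, hw, pow_mul, ← Complex.exp_nat_mul _ N, mul_assoc]
    congr 4
    ring
  · intro n hn
    rw [Finset.filter_false_of_mem, Finset.sum_empty, zero_mul]
    intro d hd hNd
    obtain ⟨k, hk⟩ := hNd.trans (Nat.dvd_of_mem_divisors hd)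
    exact hn ⟨⟨k, Nat.pos_of_mul_pos_left (hk ▸ n.pos)⟩, PNat.eq hk.symm⟩

/-- Proposition 2.1: for `N ≥ 2` and `z` in the upper half-plane,
`E(z,N) = ((N−1)/3)π² + 8π² Σ_{n≥1} (Σ_{d∣n, N∤d} d) e^{2πinz}`. -/
theorem stmt4 (N : ℕ) (hN : 2 ≤ N) (z : ℍ) :
    Efun (z : ℂ) N =
      ((N : ℂ) - 1) / 3 * (Real.pi : ℂ) ^ 2 +
        8 * (Real.pi : ℂ) ^ 2 *
          ∑' n : ℕ+, (∑ d ∈ (n : ℕ).divisors.filter (fun d => ¬ N ∣ d), (d : ℂ)) *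
            Complex.exp (2 * Real.pi * Complex.I * (n : ℕ) * (z : ℂ)) := by
  have hN0 : 0 < N := by omega
  let w : ℍ := ⟨N * z, by simpa [hN0] using z.2⟩
  have hw : (w : ℂ) = N * z := rfl
  have h := (summable_sigma_one_mul_cexp_pow z).hasSum.sub
    (hasSum_divisors_filter_dvd_mul_cexp hN0 z w hw)
  have hterm (n : ℕ+) : (∑ d ∈ (n : ℕ).divisors.filter (fun d => ¬ N ∣ d), (d : ℂ)) *
        Complex.exp (2 * Real.pi * Complex.I * (n : ℕ) * (z : ℂ)) =
      (ArithmeticFunction.sigma 1 n : ℂ) * cexp (2 * Real.pi * Complex.I * z) ^ (n : ℕ) -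
        (∑ d ∈ (n : ℕ).divisors.filter (N ∣ ·), (d : ℂ)) *
          cexp (2 * Real.pi * Complex.I * z) ^ (n : ℕ) := by
    rw [← sub_mul, ArithmeticFunction.sigma_one_apply, Nat.cast_sum,
      ← Finset.sum_filter_add_sum_filter_not (n : ℕ).divisors (N ∣ ·), add_sub_cancel_left,
      ← Complex.exp_nat_mul]
    congr 2
    ring
  rw [tsum_congr hterm, h.tsum_eq, Efun, ← hw, G2star_eq_tsum_sigma, G2star_eq_tsum_sigma]
  ring

end
end

section
/- For every even integer k > 2, the function E_{2,∞,k}(z) = Σ_{n≥1} σ*_{2,k−1}(n) q^n on the upper half-plane is an entire modular form of weight k for Γ0(2) with trivial character which vanishes at the cusp ∞ and does not vanish at the cusp 0. -/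
open Complex Filter UpperHalfPlane
open scoped MatrixGroups ModularForm

noncomputable section

/-- `q = e^{2πiz}`. -/
def qexp (z : ℂ) : ℂ := Complex.exp (2 * Real.pi * Complex.I * z)

/-- `σ*_{2,k}(n) = Σ_{d∣n, n/d odd} dᵏ`. -/
def sigmaStar2 (k n : ℕ) : ℕ := ∑ d ∈ n.divisors.filter (fun d => Odd (n / d)), d ^ k

/-- A modular form of level `Γ` viewed as a modular form of a smaller level. -/
def ModularForm.restrictLevel {Γ Γ' : Subgroup (GL (Fin 2) ℝ)} {k : ℤ} (h : Γ' ≤ Γ)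
    (f : ModularForm Γ k) : ModularForm Γ' k where
  toFun := f
  slash_action_eq' A hA := f.slash_action_eq' A (h hA)
  holo' := f.holo'
  bdd_at_cusps' hc := f.bdd_at_cusps' (hc.mono h)

/-- The diagonal matrix `diag(a, d)` as an element of `GL(2, ℝ)`. -/
def diagGL (a d : ℝ) (h : a * d ≠ 0) : GL (Fin 2) ℝ :=
  .mkOfDetNeZero !![a, 0; 0, d] (by simpa using h)

lemma coe_diagGL_smul {a d : ℝ} (h : 0 < a * d) (z : ℍ) :
    ((diagGL a d h.ne' • z : ℍ) : ℂ) = a / d * z := by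
  rw [UpperHalfPlane.coe_smul_of_det_pos (by simpa [diagGL] using h)]
  simp [diagGL, UpperHalfPlane.num, UpperHalfPlane.denom]
  ring

lemma slash_diagGL_apply {a d : ℝ} (h : 0 < a * d) (k : ℤ) (f : ℍ → ℂ) (z : ℍ) :
    (f ∣[k] diagGL a d h.ne') z =
      f (diagGL a d h.ne' • z) * ((a * d : ℝ) : ℂ) ^ (k - 1) * (d : ℂ) ^ (-k) := by
  rw [ModularForm.slash_apply]
  simp [diagGL, UpperHalfPlane.σ, UpperHalfPlane.denom, h, abs_of_pos h]

lemma tendsto_slash_diagGL {a d : ℝ} (h : 0 < a * d) (k : ℤ) {f : ℍ → ℂ} {l : ℂ}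
    (hf : Tendsto f atImInfty (nhds l)) :
    Tendsto (f ∣[k] diagGL a d h.ne') atImInfty
      (nhds (l * ((a * d : ℝ) : ℂ) ^ (k - 1) * (d : ℂ) ^ (-k))) := by
  rw [show f ∣[k] diagGL a d h.ne' = _ from funext (slash_diagGL_apply h k f)]
  exact ((hf.comp (tendsto_smul_atImInfty (by simp [diagGL]))).mul_const _).mul_const _

lemma val_mapGL_real (g : SL(2, ℤ)) :
    (Matrix.SpecialLinearGroup.mapGL ℝ g).val =
      !![((g.val 0 0 : ℤ) : ℝ), ((g.val 0 1 : ℤ) : ℝ);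
        ((g.val 1 0 : ℤ) : ℝ), ((g.val 1 1 : ℤ) : ℝ)] := by
  ext i j
  fin_cases i <;> fin_cases j <;> rfl

lemma val_diagGL (a d : ℝ) (h : a * d ≠ 0) : (diagGL a d h).val = !![a, 0; 0, d] :=
  rfl

lemma diagGL_two_one_mul_S :
    diagGL 2 1 (by simp) * (Matrix.SpecialLinearGroup.mapGL ℝ ModularGroup.S) =
      Matrix.SpecialLinearGroup.mapGL ℝ ModularGroup.S * diagGL 1 2 (by simp) := by
  refine Units.ext ?_
  rw [Units.val_mul, Units.val_mul, val_mapGL_real, val_diagGL, val_diagGL]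
  simp [ModularGroup.S]

lemma Gamma0_le_SL2Z (N : ℕ) :
    (CongruenceSubgroup.Gamma0 N : Subgroup (GL (Fin 2) ℝ)) ≤ 𝒮ℒ :=
  Subgroup.map_le_range _ _

open ConjAct Pointwise in
lemma Gamma0_two_le_conj :
    (CongruenceSubgroup.Gamma0 2 : Subgroup (GL (Fin 2) ℝ)) ≤
      toConjAct (diagGL 2 1 (by simp))⁻¹ • 𝒮ℒ := by
  rintro _ ⟨A, hA, rfl⟩
  rw [map_inv, Subgroup.mem_inv_pointwise_smul_iff, toConjAct_smul]
  have hA' : ((A 1 0 : ℤ) : ZMod 2) = 0 := hA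
  obtain ⟨c, hc⟩ := (ZMod.intCast_zmod_eq_zero_iff_dvd _ 2).mp hA'
  have hdet := A.det_coe
  rw [Matrix.det_fin_two] at hdet
  refine ⟨⟨!![A 0 0, 2 * A 0 1; c, A 1 1], ?_⟩, ?_⟩
  · rw [Matrix.det_fin_two_of]
    rw [hc] at hdet
    push_cast at hdet
    linarith
  · rw [eq_mul_inv_iff_mul_eq]
    have hc' : ((A 1 0 : ℤ) : ℝ) = 2 * c := by rw [hc]; push_cast; ring
    refine Units.ext ?_
    rw [Units.val_mul]
    erw [Units.val_mul, val_mapGL_real, val_mapGL_real]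
    rw [val_diagGL, hc']
    simp [mul_comm]

lemma tendsto_E_atImInfty {k : ℕ} (hk : 3 ≤ k) (hk2 : Even k) :
    Tendsto (ModularForm.E hk) atImInfty (nhds 1) := by
  have hΓ : (1 : ℝ) ∈ Subgroup.strictPeriods 𝒮ℒ := by simp
  have h0 : cuspFunction 1 (ModularForm.E hk) 0 = 1 := by
    simpa [qExpansion_coeff] using EisensteinSeries.E_qExpansion_coeff_zero hk hk2
  have h := (ModularFormClass.analyticAt_cuspFunction_zero (ModularForm.E hk) one_pos
    hΓ).continuousAt.tendsto.comp (qParam_tendsto_atImInfty one_pos)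
  rw [h0] at h
  refine h.congr fun z ↦ ?_
  exact SlashInvariantFormClass.eq_cuspFunction _ z hΓ one_ne_zero

lemma sigmaStar2_of_not_dvd (k : ℕ) {n : ℕ} (hn : ¬ 2 ∣ n) :
    sigmaStar2 k n = ArithmeticFunction.sigma k n := by
  rw [sigmaStar2, ArithmeticFunction.sigma_apply, Finset.filter_true_of_mem]
  intro d hd
  rw [← Nat.not_even_iff_odd, even_iff_two_dvd]
  exact fun h ↦ hn (h.trans (Nat.div_dvd_of_dvd (Nat.dvd_of_mem_divisors hd)))

lemma sigmaStar2_two_mul (k m : ℕ) :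
    sigmaStar2 k (2 * m) + ArithmeticFunction.sigma k m =
      ArithmeticFunction.sigma k (2 * m) := by
  rcases eq_or_ne m 0 with rfl | hm
  · simp [sigmaStar2]
  rw [sigmaStar2, ArithmeticFunction.sigma_apply, ArithmeticFunction.sigma_apply,
    ← Finset.sum_filter_add_sum_filter_not (2 * m).divisors (fun d ↦ Odd (2 * m / d))]
  congr 2
  ext d
  simp only [Nat.mem_divisors, Finset.mem_filter, Nat.not_odd_iff_even]
  constructor
  · rintro ⟨⟨c, rfl⟩, -⟩
    have hd : 0 < d := Nat.pos_of_ne_zero (by grind)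
    refine ⟨⟨⟨2 * c, by ring⟩, by grind⟩, ?_⟩
    rw [show 2 * (d * c) = d * (2 * c) by ring, Nat.mul_div_cancel_left _ hd]
    simp
  · rintro ⟨⟨⟨c, hc⟩, -⟩, h⟩
    have hd : 0 < d := Nat.pos_of_ne_zero (by grind)
    rw [hc, Nat.mul_div_cancel_left _ hd] at h
    obtain ⟨e, rfl⟩ := h
    exact ⟨⟨e, by linarith⟩, hm⟩

lemma tsum_sigmaStar2_mul_pow {k : ℕ} {q : ℂ}
    (h : Summable fun n : ℕ+ ↦ (ArithmeticFunction.sigma k n : ℂ) * q ^ (n : ℕ))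
    (h2 : Summable fun n : ℕ+ ↦ (ArithmeticFunction.sigma k n : ℂ) * (q ^ 2) ^ (n : ℕ)) :
    ∑' n : ℕ+, (sigmaStar2 k n : ℂ) * q ^ (n : ℕ) =
      ∑' n : ℕ+, (ArithmeticFunction.sigma k n : ℂ) * q ^ (n : ℕ) -
        ∑' n : ℕ+, (ArithmeticFunction.sigma k n : ℂ) * (q ^ 2) ^ (n : ℕ) := by
  have hinj : Function.Injective fun n : ℕ+ ↦ 2 * n := fun a b hab ↦ mul_left_cancel hab
  set g : ℕ+ → ℂ := fun n ↦
    ((ArithmeticFunction.sigma k n : ℂ) - sigmaStar2 k n) * q ^ (n : ℕ)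
  have hcomp : g ∘ (fun n : ℕ+ ↦ 2 * n) =
      fun n : ℕ+ ↦ (ArithmeticFunction.sigma k n : ℂ) * (q ^ 2) ^ (n : ℕ) := by
    ext n
    simp only [g, Function.comp, PNat.mul_coe, PNat.val_ofNat, ← sigmaStar2_two_mul, pow_mul]
    push_cast
    ring
  have hsupp : ∀ n ∉ Set.range (fun n : ℕ+ ↦ 2 * n), g n = 0 := by
    intro n hn
    have : ¬ 2 ∣ (n : ℕ) := fun ⟨c, hc⟩ ↦
      hn ⟨⟨c, by have := n.pos; omega⟩, PNat.eq hc.symm⟩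
    simp [g, sigmaStar2_of_not_dvd k this]
  have hg : HasSum g (∑' n : ℕ+, (ArithmeticFunction.sigma k n : ℂ) * (q ^ 2) ^ (n : ℕ)) := by
    rw [← hinj.hasSum_iff hsupp, hcomp]
    exact h2.hasSum
  rw [← (h.hasSum.sub hg).tsum_eq]
  congr! 2 with n
  ring

/-- The proportionality constant between `E k - 1` and `∑ σ (k - 1) n qⁿ`. -/
def eisensteinConst (k : ℕ) : ℂ :=
  (riemannZeta k)⁻¹ * (-2 * Real.pi * Complex.I) ^ k / (k - 1).factorial

lemma eisensteinConst_ne_zero {k : ℕ} (hk : 2 < k) : eisensteinConst k ≠ 0 := by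
  have hζ : riemannZeta k ≠ 0 :=
    riemannZeta_ne_zero_of_one_le_re (by simp; omega)
  simp [eisensteinConst, hζ, Nat.factorial_ne_zero, Real.pi_ne_zero]

lemma tsum_sigmaStar2_mul_qexp {k : ℕ} (hk : 3 ≤ k) (hk2 : Even k) (z : ℍ) :
    ∑' n : ℕ+, (sigmaStar2 (k - 1) n : ℂ) * qexp z ^ (n : ℕ) =
      (eisensteinConst k)⁻¹ * (ModularForm.E hk z -
        ModularForm.E hk (diagGL 2 1 (by simp) • z)) := by
  have hsum (w : ℍ) : Summable fun n : ℕ+ ↦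
      (ArithmeticFunction.sigma (k - 1) n : ℂ) * qexp w ^ (n : ℕ) :=
    (EisensteinSeries.summable_sigma_mul_cexp_pow (by omega) w).comp_injective
      PNat.coe_injective
  have hE (w : ℍ) : ModularForm.E hk w = 1 + eisensteinConst k *
      ∑' n : ℕ+, (ArithmeticFunction.sigma (k - 1) n : ℂ) * qexp w ^ (n : ℕ) := by
    simpa [eisensteinConst, qexp] using EisensteinSeries.q_expansion_riemannZeta hk hk2 w
  have hq : qexp (diagGL 2 1 (by simp) • z : ℍ) = qexp z ^ 2 := by
    rw [coe_diagGL_smul (by simp), qexp, qexp, ← Complex.exp_nat_mul]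
    congr 1
    push_cast
    ring
  have h2 := hsum (diagGL 2 1 (by simp) • z)
  rw [hq] at h2
  rw [tsum_sigmaStar2_mul_pow (hsum z) h2, hE, hE, hq, eq_inv_mul_iff_mul_eq₀
    (eisensteinConst_ne_zero (by omega))]
  ring

/-- Proposition 2.2 together with Remark 2.1: for even `k > 2`, the series
`E_{2,∞,k}(z) = Σ_{n≥1} σ*_{2,k−1}(n) qⁿ` is an entire modular form of weight `k` for
`Γ₀(2)` with trivial character, vanishing at the cusp `∞` but not at the cusp `0`. -/
theorem stmt5 (k : ℕ) (hk : 2 < k) (hkeven : Even k) :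
    ∃ F : ModularForm (CongruenceSubgroup.Gamma0 2) (k : ℤ),
      (∀ z : ℍ, F z = ∑' n : ℕ+, (sigmaStar2 (k - 1) n : ℂ) * qexp (z : ℂ) ^ (n : ℕ)) ∧
      Filter.Tendsto F UpperHalfPlane.atImInfty (nhds 0) ∧
      ∃ L : ℂ, L ≠ 0 ∧
        Filter.Tendsto (⇑F ∣[(k : ℤ)] ModularGroup.S) UpperHalfPlane.atImInfty (nhds L) := by
  have hα : (2 : ℝ) * 1 ≠ 0 := by simp
  set E := ModularForm.E (show 3 ≤ k from hk)
  set V := ModularForm.translate E (diagGL 2 1 hα)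
  set C := (eisensteinConst k)⁻¹
  have hC : C ≠ 0 := inv_ne_zero (eisensteinConst_ne_zero hk)
  set a : ℂ := ((2 : ℂ) ^ ((k : ℤ) - 1))⁻¹
  have ha : (2 : ℂ) ^ ((k : ℤ) - 1) ≠ 0 := zpow_ne_zero _ two_ne_zero
  have hE1 : Tendsto E atImInfty (nhds 1) := tendsto_E_atImInfty hk hkeven
  let F : ModularForm (CongruenceSubgroup.Gamma0 2) (k : ℤ) :=
    C • (E.restrictLevel (Gamma0_le_SL2Z 2) - a • V.restrictLevel Gamma0_two_le_conj)
  have hF : ⇑F = C • (⇑E + (-a) • ⇑E ∣[(k : ℤ)] diagGL 2 1 hα) := by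
    ext z
    change C * (E z - a * (⇑E ∣[(k : ℤ)] diagGL 2 1 hα) z) =
      C * (E z + (-a) * (⇑E ∣[(k : ℤ)] diagGL 2 1 hα) z)
    ring
  have hlim (b d : ℝ) (h : 0 < b * d) :
      Tendsto (C • (⇑E + (-a) • ⇑E ∣[(k : ℤ)] diagGL b d h.ne')) atImInfty
        (nhds (C * (1 - a * (((b * d : ℝ) : ℂ) ^ ((k : ℤ) - 1) * (d : ℂ) ^ (-(k : ℤ)))))) := by
    have e : C * (1 - a * (((b * d : ℝ) : ℂ) ^ ((k : ℤ) - 1) * (d : ℂ) ^ (-(k : ℤ)))) =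
        C • (1 + (-a) • (1 * ((b * d : ℝ) : ℂ) ^ ((k : ℤ) - 1) * (d : ℂ) ^ (-(k : ℤ)))) := by
      simp only [smul_eq_mul]
      ring
    rw [e]
    exact (hE1.add ((tendsto_slash_diagGL h k hE1).const_smul (-a))).const_smul C
  refine ⟨F, fun z ↦ ?_, ?_, C * (1 - a * (2 ^ ((k : ℤ) - 1) * 2 ^ (-(k : ℤ)))), ?_, ?_⟩
  · rw [tsum_sigmaStar2_mul_qexp hk hkeven, hF]
    simp only [Pi.smul_apply, Pi.add_apply, smul_eq_mul]
    rw [slash_diagGL_apply (by simp)]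
    simp only [a, mul_one, ofReal_one, one_zpow, ofReal_ofNat]
    field_simp
    ring
  · rw [hF]
    simpa [inv_mul_cancel₀ ha, a] using hlim 2 1 (by simp)
  · refine mul_ne_zero hC ?_
    rw [← mul_assoc, inv_mul_cancel₀ ha, one_mul, sub_ne_zero, zpow_neg, zpow_natCast]
    intro h
    have h2 := congrArg (‖·‖) h
    simp only [norm_one, norm_inv, norm_pow, Complex.norm_ofNat] at h2
    exact (inv_lt_one_of_one_lt₀ (one_lt_pow₀ one_lt_two (by omega : k ≠ 0))).ne' h2
  · have hES : ⇑E ∣[(k : ℤ)] (Matrix.SpecialLinearGroup.mapGL ℝ ModularGroup.S) = ⇑E :=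
      SlashInvariantFormClass.slash_action_eq E _ ⟨_, rfl⟩
    have hSL (f : ℍ → ℂ) : f ∣[(k : ℤ)] ModularGroup.S =
      f ∣[(k : ℤ)] (Matrix.SpecialLinearGroup.mapGL ℝ ModularGroup.S) := rfl
    rw [hF, ModularForm.SL_smul_slash, SlashAction.add_slash, ModularForm.SL_smul_slash,
      hSL, hSL, hES, ← SlashAction.slash_mul,
      diagGL_two_one_mul_S, SlashAction.slash_mul, hES]
    have h := hlim 1 2 (by simp)
    simp only [one_mul, ofReal_ofNat] at h
    exact h

end
end

section
/- For z in the upper half-plane, E_{∞,4}(z) = η(2z)^{16} η(z)^{−8}, and consequently E_{∞,4} has the product expansion E_{∞,4}(z) = q · Π_{n>0 even} (1−q^n)^8 · Π_{n>0 odd} (1−q^n)^{−8} in the variable q = e^{2πiz}. -/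
open Complex Filter UpperHalfPlane
open scoped MatrixGroups ModularForm Manifold

noncomputable section

/-- `σ^odd(n) = Σ_{d∣n, d odd} d`. -/
def sigmaOdd (n : ℕ) : ℕ := ∑ d ∈ n.divisors.filter (fun d => Odd d), d

/-- `σ₃^alt(n) = Σ_{d∣n} (-1)^d d³`. -/
def sigma3Alt (n : ℕ) : ℤ := ∑ d ∈ n.divisors, (-1 : ℤ) ^ d * (d : ℤ) ^ 3

/-- `σ*_{2,3}(n) = Σ_{d∣n, n/d odd} d³`. -/
def sigmaStar3 (n : ℕ) : ℕ := ∑ d ∈ n.divisors.filter (fun d => Odd (n / d)), d ^ 3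

/-- `E_{γ,2} = 1 + 24 Σ σ^odd(n) qⁿ`. -/
def Egamma2 (z : ℂ) : ℂ := 1 + 24 * ∑' n : ℕ+, (sigmaOdd n : ℂ) * qexp z ^ (n : ℕ)

/-- `E_{0,4} = 1 + 16 Σ σ₃^alt(n) qⁿ`. -/
def E04 (z : ℂ) : ℂ := 1 + 16 * ∑' n : ℕ+, (sigma3Alt n : ℂ) * qexp z ^ (n : ℕ)

/-- `E_{∞,4} = Σ σ*_{2,3}(n) qⁿ`. -/
def Einf4 (z : ℂ) : ℂ := ∑' n : ℕ+, (sigmaStar3 n : ℂ) * qexp z ^ (n : ℕ)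

/-- `j₂ = E_{γ,2}² / E_{∞,4}`. -/
def j2 (z : ℂ) : ℂ := Egamma2 z ^ 2 / Einf4 z

/-- The Dedekind eta function `η(z) = e^{πiz/12} Π_{n≥1} (1 − qⁿ)`. -/
def dedekindEta (z : ℂ) : ℂ :=
  Complex.exp (Real.pi * Complex.I * z / 12) * ∏' n : ℕ+, (1 - qexp z ^ (n : ℕ))

open ModularForm CongruenceSubgroup Topology
open scoped ArithmeticFunction.sigma

/-- The map `z ↦ 2z` on the upper half-plane. -/
def dilateTwo (z : ℍ) : ℍ := (⟨2, two_pos⟩ : {x : ℝ // 0 < x}) • z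

/-- The map `z ↦ z/2` on the upper half-plane. -/
def dilateHalf (z : ℍ) : ℍ := (⟨2⁻¹, inv_pos.2 two_pos⟩ : {x : ℝ // 0 < x}) • z

lemma coe_dilateTwo (z : ℍ) : (dilateTwo z : ℂ) = 2 * z := by
  simp [dilateTwo, coe_pos_real_smul]

lemma coe_dilateHalf (z : ℍ) : (dilateHalf z : ℂ) = z / 2 := by
  simp [dilateHalf, coe_pos_real_smul]
  ring

lemma dilateTwo_dilateHalf (z : ℍ) : dilateTwo (dilateHalf z) = z := by
  ext
  rw [coe_dilateTwo, coe_dilateHalf]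
  ring

lemma tendsto_dilateTwo : Tendsto dilateTwo atImInfty atImInfty := by
  refine tendsto_comap_iff.2 ?_
  have : UpperHalfPlane.im ∘ dilateTwo = fun z : ℍ => 2 * z.im := by
    ext z
    simp [dilateTwo, UpperHalfPlane.pos_real_im]
  rw [this]
  exact tendsto_comap.const_mul_atTop two_pos

lemma tendsto_dilateHalf : Tendsto dilateHalf atImInfty atImInfty := by
  refine tendsto_comap_iff.2 ?_
  have : UpperHalfPlane.im ∘ dilateHalf = fun z : ℍ => 2⁻¹ * z.im := by
    ext z
    simp [dilateHalf, UpperHalfPlane.pos_real_im]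
  rw [this]
  exact tendsto_comap.const_mul_atTop (inv_pos.2 two_pos)

lemma levelOne_smul_eq {F : Type*} [FunLike F ℍ ℂ] {k : ℤ} [SlashInvariantFormClass F 𝒮ℒ k]
    (f : F) (γ : SL(2, ℤ)) (z : ℍ) :
    f (γ • z) = ((γ 1 0 : ℂ) * z + γ 1 1) ^ k * f z := by
  have : SlashInvariantFormClass F Γ(1) k := Gamma_one_coe_eq_SL ▸ ‹_›
  simpa [denom] using SlashInvariantForm.slash_action_eqn_SL'' f (mem_Gamma_one γ) z

lemma E₄_smul (γ : SL(2, ℤ)) (z : ℍ) : E₄ (γ • z) = ((γ 1 0 : ℂ) * z + γ 1 1) ^ 4 * E₄ z :=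
  levelOne_smul_eq E₄ γ z

lemma discriminant_smul (γ : SL(2, ℤ)) (z : ℍ) :
    discriminant (γ • z) = ((γ 1 0 : ℂ) * z + γ 1 1) ^ 12 * discriminant z :=
  levelOne_smul_eq CuspForm.discriminant γ z

lemma exists_dilateTwo_smul {γ : SL(2, ℤ)} (hγ : γ ∈ Gamma0 2) :
    ∃ γ' : SL(2, ℤ), ∀ z : ℍ, dilateTwo (γ • z) = γ' • dilateTwo z ∧
      (γ' 1 0 : ℂ) * dilateTwo z + γ' 1 1 = (γ 1 0 : ℂ) * z + γ 1 1 := by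
  rw [Gamma0_mem] at hγ
  obtain ⟨c, hc⟩ := (ZMod.intCast_zmod_eq_zero_iff_dvd _ 2).1 hγ
  have hdet := γ.det_coe
  rw [Matrix.det_fin_two, hc] at hdet
  obtain ⟨γ', h00, h01, h10, h11⟩ : ∃ γ' : SL(2, ℤ),
      γ' 0 0 = γ 0 0 ∧ γ' 0 1 = 2 * γ 0 1 ∧ γ' 1 0 = c ∧ γ' 1 1 = γ 1 1 :=
    ⟨⟨!![γ 0 0, 2 * γ 0 1; c, γ 1 1], by
      rw [Matrix.det_fin_two_of]
      linear_combination hdet⟩, by simp⟩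
  refine ⟨γ', fun z => ⟨?_, ?_⟩⟩
  · ext
    rw [coe_dilateTwo, coe_specialLinearGroup_apply, coe_specialLinearGroup_apply, coe_dilateTwo,
      h00, h01, h10, h11, hc]
    simp
    ring
  · rw [coe_dilateTwo, h10, h11, hc]
    push_cast
    ring

lemma dilateTwo_S_smul (z : ℍ) :
    dilateTwo (ModularGroup.S • z) = ModularGroup.S • dilateHalf z := by
  ext
  have := z.ne_zero
  rw [coe_dilateTwo, modular_S_smul, modular_S_smul]
  simp only [coe_dilateHalf]
  field_simp

lemma qexp_eq_qParam (z : ℂ) : qexp z = Function.Periodic.qParam 1 z := by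
  simp [qexp, Function.Periodic.qParam]

lemma qexp_two_mul (z : ℂ) : qexp (2 * z) = qexp z ^ 2 := by
  rw [qexp, qexp, ← Complex.exp_nat_mul]
  congr 1
  push_cast
  ring

lemma tendsto_qexp : Tendsto (fun z : ℍ => qexp z) atImInfty (𝓝 0) := by
  simpa only [qexp_eq_qParam] using qParam_tendsto_atImInfty one_pos

lemma norm_qexp_lt_one (z : ℍ) : ‖qexp z‖ < 1 := norm_exp_two_pi_I_lt_one z

lemma qexp_ne_zero (z : ℂ) : qexp z ≠ 0 := Complex.exp_ne_zero _

/-- The Euler product `∏ (1 - qⁿ)`. -/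
def eulerProd (q : ℂ) : ℂ := ∏' n : ℕ, (1 - q ^ (n + 1))

lemma tendsto_eulerProd : Tendsto eulerProd (𝓝 0) (𝓝 1) := by
  have h : ContinuousAt eulerProd 0 := (differentiableOn_tprod_one_sub_pow.differentiableAt
    (Metric.isOpen_ball.mem_nhds (Metric.mem_ball_self one_pos))).continuousAt
  simpa [ContinuousAt, eulerProd] using h

lemma eta_pow_eight (z : ℂ) : ModularForm.eta z ^ 8 = Complex.exp (2 * Real.pi * Complex.I * z / 3) *
    eulerProd (qexp z) ^ 8 := by
  rw [ModularForm.eta, mul_pow, Function.Periodic.qParam, ← Complex.exp_nat_mul]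
  simp only [eta_q, ← qexp_eq_qParam, eulerProd]
  congr 2
  push_cast
  ring

lemma exp_third_pow_three (z : ℂ) :
    Complex.exp (2 * Real.pi * Complex.I * z / 3) ^ 3 = qexp z := by
  rw [← Complex.exp_nat_mul, qexp]
  congr 1
  push_cast
  ring

lemma eulerProd_ne_zero (z : ℍ) : eulerProd (qexp z) ≠ 0 := by
  have := eta_tprod_ne_zero z.2
  simpa only [eta_q, ← qexp_eq_qParam, eulerProd] using this

lemma eta_quotient_eq (z : ℂ) : ModularForm.eta (2 * z) ^ 16 / ModularForm.eta z ^ 8 =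
    qexp z * (eulerProd (qexp z ^ 2) ^ 16 / eulerProd (qexp z) ^ 8) := by
  have h : Complex.exp (2 * Real.pi * Complex.I * (2 * z) / 3) =
      Complex.exp (2 * Real.pi * Complex.I * z / 3) ^ 2 := by
    rw [← Complex.exp_nat_mul]
    congr 1
    push_cast
    ring
  rw [show 16 = 8 * 2 from rfl, pow_mul, pow_mul, eta_pow_eight, eta_pow_eight, h, qexp_two_mul,
    ← exp_third_pow_three z]
  have := Complex.exp_ne_zero (2 * Real.pi * Complex.I * z / 3)
  field_simp

lemma discriminant_eq_qexp_mul (z : ℍ) :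
    discriminant z = qexp z * eulerProd (qexp z) ^ 24 := by
  rw [discriminant, show 24 = 8 * 3 from rfl, pow_mul, eta_pow_eight, mul_pow,
    exp_third_pow_three, ← pow_mul]

lemma E₄_eq_cuspFunction (z : ℍ) : E₄ z = cuspFunction 1 E₄ (qexp z) := by
  rw [qexp_eq_qParam]
  exact (SlashInvariantFormClass.eq_cuspFunction E₄ z one_mem_strictPeriods_SL one_ne_zero).symm

lemma cuspFunction_E₄_zero : cuspFunction 1 E₄ 0 = 1 := by
  have := EisensteinSeries.E_qExpansion_coeff_zero (k := 4) (by norm_num) ⟨2, rfl⟩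
  simpa [qExpansion_coeff] using this

lemma hasDerivAt_cuspFunction_E₄ : HasDerivAt (cuspFunction 1 E₄) 240 0 := by
  have h := E₄_qExpansion_coeff_one
  have hd := (ModularFormClass.differentiableAt_cuspFunction E₄ one_pos
    one_mem_strictPeriods_SL (q := 0) (by simp)).hasDerivAt
  rw [qExpansion_coeff] at h
  simp only [Nat.factorial_one, Nat.cast_one, inv_one, one_mul, iteratedDeriv_one] at h
  rwa [h] at hd

lemma tendsto_E₄ : Tendsto (fun z : ℍ => E₄ z) atImInfty (𝓝 1) := by
  have h := hasDerivAt_cuspFunction_E₄.continuousAt.tendsto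
  rw [cuspFunction_E₄_zero] at h
  exact (h.comp tendsto_qexp).congr fun z => (E₄_eq_cuspFunction z).symm

lemma qexp_dilateTwo (z : ℍ) : qexp (dilateTwo z) = qexp z ^ 2 := by
  rw [coe_dilateTwo, qexp_two_mul]

lemma tendsto_E₄_sub_div :
    Tendsto (fun z : ℍ => (E₄ z - E₄ (dilateTwo z)) / qexp z) atImInfty (𝓝 240) := by
  have h2 : HasDerivAt (fun q : ℂ => cuspFunction 1 E₄ (q ^ 2)) 0 0 := by
    have h := HasDerivAt.comp (h₂ := cuspFunction 1 E₄) (h := fun q : ℂ => q ^ 2) (0 : ℂ)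
      (by simpa using hasDerivAt_cuspFunction_E₄) (hasDerivAt_pow 2 (0 : ℂ))
    simpa [Function.comp_def] using h
  have h := (hasDerivAt_cuspFunction_E₄.sub h2).tendsto_slope
  have hq : Tendsto (fun z : ℍ => qexp z) atImInfty (𝓝[≠] 0) :=
    tendsto_nhdsWithin_iff.2 ⟨tendsto_qexp, .of_forall fun z => qexp_ne_zero _⟩
  rw [sub_zero] at h
  refine (h.comp hq).congr fun z => ?_
  rw [E₄_eq_cuspFunction, E₄_eq_cuspFunction, qexp_dilateTwo]
  simp [slope_def_field]

/-- The quotient of `240 E_{∞,4}` by the eta quotient `η(2z)¹⁶ η(z)⁻⁸`. -/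
def etaRatio (z : ℍ) : ℂ :=
  (E₄ z - E₄ (dilateTwo z)) / (ModularForm.eta (2 * z) ^ 16 / ModularForm.eta z ^ 8)

lemma eta_quotient_ne_zero (z : ℍ) : ModularForm.eta (2 * z) ^ 16 / ModularForm.eta z ^ 8 ≠ 0 := by
  rw [← coe_dilateTwo]
  exact div_ne_zero (pow_ne_zero _ (eta_ne_zero (dilateTwo z).2)) (pow_ne_zero _ (eta_ne_zero z.2))

lemma etaRatio_pow_three (z : ℍ) : etaRatio z ^ 3 =
    (E₄ z - E₄ (dilateTwo z)) ^ 3 * discriminant z / discriminant (dilateTwo z) ^ 2 := by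
  have h1 := eta_ne_zero z.2
  have h2 := eta_ne_zero (dilateTwo z).2
  rw [etaRatio, discriminant, discriminant, ← coe_dilateTwo]
  change ModularForm.eta (dilateTwo z) ≠ 0 at h2
  change ModularForm.eta z ≠ 0 at h1
  field_simp

lemma tendsto_etaRatio : Tendsto etaRatio atImInfty (𝓝 240) := by
  have hp := tendsto_eulerProd.comp tendsto_qexp
  have hp2 := tendsto_eulerProd.comp (tendsto_qexp.comp tendsto_dilateTwo)
  have h := tendsto_E₄_sub_div.mul ((hp.pow 8).div (hp2.pow 16) (by simp))
  simp only [one_pow, div_one, mul_one] at h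
  refine h.congr fun z => ?_
  have h1 := eulerProd_ne_zero z
  have h2 := eulerProd_ne_zero (dilateTwo z)
  rw [etaRatio, eta_quotient_eq]
  simp only [Function.comp_apply, Pi.div_apply, qexp_dilateTwo] at h2 ⊢
  have := qexp_ne_zero z
  field_simp

lemma etaRatio_pow_three_smul {γ : SL(2, ℤ)} (hγ : γ ∈ Gamma0 2) (z : ℍ) :
    etaRatio (γ • z) ^ 3 = etaRatio z ^ 3 := by
  obtain ⟨γ', h⟩ := exists_dilateTwo_smul hγ
  obtain ⟨h1, h2⟩ := h z
  have hd : (γ 1 0 : ℂ) * z + γ 1 1 ≠ 0 := by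
    simpa [denom] using denom_ne_zero (γ : GL (Fin 2) ℝ) z
  have hΔ := discriminant_ne_zero (dilateTwo z)
  rw [etaRatio_pow_three, etaRatio_pow_three, h1, E₄_smul, E₄_smul, discriminant_smul,
    discriminant_smul, h2]
  field_simp

lemma tendsto_etaRatio_S_smul_pow_three : Tendsto (fun z : ℍ => etaRatio (ModularGroup.S • z) ^ 3)
    atImInfty (𝓝 (2 ^ 24 * (1 - 1 / 16) ^ 3)) := by
  have hp := tendsto_eulerProd.comp tendsto_qexp
  have hp2 := hp.comp tendsto_dilateHalf
  have h := (((tendsto_E₄.sub ((tendsto_E₄.comp tendsto_dilateHalf).div_const 16)).pow 3).const_mul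
    (2 ^ 24)).mul ((hp.pow 24).div (hp2.pow 48) (by simp))
  simp only [one_pow, div_one, mul_one] at h
  refine h.congr fun z => ?_
  have h2 := eulerProd_ne_zero (dilateHalf z)
  have hz := z.ne_zero
  have hq : qexp z = qexp (dilateHalf z) ^ 2 := by rw [← qexp_dilateTwo, dilateTwo_dilateHalf]
  have := qexp_ne_zero (dilateHalf z)
  rw [etaRatio_pow_three, dilateTwo_S_smul, E₄_smul, E₄_smul, discriminant_smul, discriminant_smul,
    discriminant_eq_qexp_mul, discriminant_eq_qexp_mul, hq]
  simp only [ModularGroup.S, Pi.div_apply, Function.comp_apply, hq]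
  simp
  simp only [coe_dilateHalf] at h2 this ⊢
  field_simp
  ring

lemma mdifferentiable_dilateTwo : MDiff dilateTwo := by
  intro z
  have h : MDiffAt (fun w : ℍ => (2 : ℂ) * w) z :=
    mdifferentiableAt_const.mul mdifferentiable_coe.mdifferentiableAt
  have := (mdifferentiableAt_ofComplex (z := 2 * (z : ℂ)) (by simpa using z.im_pos)).comp z h
  have he : dilateTwo = ofComplex ∘ fun w : ℍ => 2 * (w : ℂ) := by
    ext w
    simp [← coe_dilateTwo]
  rwa [he]

lemma mdifferentiable_etaRatio_pow_three : MDiff (fun z => etaRatio z ^ 3) := by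
  have h1 : MDiff (fun z : ℍ => E₄ z) := E₄.holo'
  have h2 : MDiff (fun z : ℍ => E₄ (dilateTwo z)) := h1.comp mdifferentiable_dilateTwo
  have h3 : MDiff (fun z : ℍ => discriminant z) := CuspForm.discriminant.holo'
  have h4 : MDiff (fun z : ℍ => discriminant (dilateTwo z)) := h3.comp mdifferentiable_dilateTwo
  have h5 := (((h1.sub h2).pow 3).mul h3).div (h4.pow 2)
    fun z => pow_ne_zero 2 (discriminant_ne_zero (dilateTwo z))
  rw [funext etaRatio_pow_three]
  exact h5

lemma slash_zero_apply (f : ℍ → ℂ) (γ : SL(2, ℤ)) (z : ℍ) :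
    (f ∣[(0 : ℤ)] γ) z = f (γ • z) := by
  simp [SL_slash_apply]

lemma isBoundedAtImInfty_etaRatio_pow_three (γ : SL(2, ℤ)) :
    IsBoundedAtImInfty (fun z => etaRatio (γ • z) ^ 3) := by
  obtain hγ | ⟨j, hj⟩ : γ ∈ Gamma0 2 ∨ ∃ j : ℤ,
      γ * (ModularGroup.S * ModularGroup.T ^ j)⁻¹ ∈ Gamma0 2 := by
    have hval (j : ℤ) : (γ * (ModularGroup.S * ModularGroup.T ^ j)⁻¹) 1 0 =
        γ 1 0 * j - γ 1 1 := by
      rw [mul_inv_rev, ← zpow_neg, ← mul_assoc]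
      simp [ModularGroup.coe_T_zpow, ModularGroup.coe_S, Matrix.mul_apply]
      ring
    by_cases h : (2 : ℤ) ∣ γ 1 0
    · exact .inl (Gamma0_mem.2 ((ZMod.intCast_zmod_eq_zero_iff_dvd _ 2).2 h))
    · refine .inr ⟨γ 1 1, Gamma0_mem.2 ((ZMod.intCast_zmod_eq_zero_iff_dvd _ 2).2 ?_)⟩
      rw [hval, ← sub_one_mul]
      exact (by omega : (2 : ℤ) ∣ γ 1 0 - 1).mul_right _
  · simp only [etaRatio_pow_three_smul hγ]
    exact (tendsto_etaRatio.pow 3).isBigO_one ℝ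
  · have h (z : ℍ) : etaRatio (γ • z) ^ 3 =
        etaRatio (ModularGroup.S • ((j : ℝ) +ᵥ z)) ^ 3 := by
      rw [← modular_T_zpow_smul, ← mul_smul, ← etaRatio_pow_three_smul hj ((ModularGroup.S * _) • z),
        ← mul_smul, inv_mul_cancel_right]
    simp only [h]
    have ht : Tendsto (fun z : ℍ => (j : ℝ) +ᵥ z) atImInfty atImInfty := by
      refine tendsto_comap_iff.2 ?_
      simpa [Function.comp_def, atImInfty] using tendsto_comap
    exact (tendsto_etaRatio_S_smul_pow_three.comp ht).isBigO_one ℝ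

/-- The cube of `etaRatio` as a modular form of weight zero. -/
def etaRatioCube : ModularForm (Gamma0 2 : Subgroup (GL (Fin 2) ℝ)) 0 where
  toFun z := etaRatio z ^ 3
  slash_action_eq' γ hγ := by
    obtain ⟨γ, hγ, rfl⟩ := hγ
    ext z
    exact (slash_zero_apply _ γ z).trans (etaRatio_pow_three_smul hγ z)
  holo' := mdifferentiable_etaRatio_pow_three
  bdd_at_cusps' {c} hc := by
    rw [Subgroup.IsArithmetic.isCusp_iff_isCusp_SL2Z] at hc
    rw [OnePoint.isBoundedAt_iff_forall_SL2Z hc]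
    intro γ _
    convert isBoundedAtImInfty_etaRatio_pow_three γ using 1
    ext z
    exact slash_zero_apply _ γ z

lemma etaRatio_pow_three_eq (z : ℍ) : etaRatio z ^ 3 = 240 ^ 3 := by
  obtain ⟨c, hc⟩ := ModularForm.eq_const_of_weight_zero etaRatioCube
  have h (w : ℍ) : etaRatio w ^ 3 = c := congrFun hc w
  have := tendsto_etaRatio.pow 3
  simp only [funext h] at this
  exact (h z).trans (tendsto_nhds_unique tendsto_const_nhds this)

lemma continuous_etaRatio : Continuous etaRatio := by
  have hη : Continuous fun z : ℍ => ModularForm.eta z := continuous_iff_continuousAt.2 fun z =>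
    (differentiableAt_eta_of_mem_upperHalfPlaneSet z.2).continuousAt.comp continuous_coe.continuousAt
  have hE : Continuous fun z : ℍ => E₄ z := E₄.holo'.continuous
  have hd := mdifferentiable_dilateTwo.continuous
  have h := (hE.sub (hE.comp hd)).div (((hη.comp hd).pow 16).div (hη.pow 8)
    fun z => pow_ne_zero _ (eta_ne_zero z.2)) fun z => by
      simpa [coe_dilateTwo] using eta_quotient_ne_zero z
  convert h using 1
  ext z
  simp [etaRatio, coe_dilateTwo]

lemma etaRatio_eq (z : ℍ) : etaRatio z = 240 := by
  have hfin : {w : ℂ | w ^ 3 = 240 ^ 3}.Finite := by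
    simpa [Polynomial.IsRoot, sub_eq_zero] using Polynomial.finite_setOfPred_isRoot
      (Polynomial.X_pow_sub_C_ne_zero three_pos (240 ^ 3 : ℂ))
  have h (w : ℍ) : etaRatio w = etaRatio z :=
    isPreconnected_univ.constant_of_mapsTo hfin.isDiscrete continuous_etaRatio.continuousOn
      (fun w _ => etaRatio_pow_three_eq w) (Set.mem_univ w) (Set.mem_univ z)
  exact tendsto_nhds_unique (tendsto_const_nhds.congr fun w => (h w).symm) tendsto_etaRatio

lemma E₄_sub_E₄_dilateTwo (z : ℍ) :
    E₄ z - E₄ (dilateTwo z) = 240 * (ModularForm.eta (2 * z) ^ 16 / ModularForm.eta z ^ 8) := by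
  rw [← etaRatio_eq z, etaRatio, div_mul_cancel₀ _ (eta_quotient_ne_zero z)]

lemma sigma_three_two_mul (m : ℕ) :
    σ 3 (2 * m) = sigmaStar3 (2 * m) + σ 3 m := by
  obtain rfl | hm := m.eq_zero_or_pos
  · simp [sigmaStar3]
  rw [ArithmeticFunction.sigma_apply, ArithmeticFunction.sigma_apply, sigmaStar3,
    ← Finset.sum_filter_add_sum_filter_not _ (fun d => Odd (2 * m / d))]
  congr 2
  ext d
  simp only [Finset.mem_filter, Nat.mem_divisors, Nat.not_odd_iff_even]
  constructor
  · rintro ⟨⟨⟨e, he⟩, -⟩, h⟩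
    have hd : 0 < d := by
      by_contra hd
      obtain rfl : d = 0 := by omega
      omega
    rw [he, Nat.mul_div_cancel_left _ hd] at h
    obtain ⟨k, rfl⟩ := h
    exact ⟨⟨k, by linarith⟩, hm.ne'⟩
  · rintro ⟨⟨e, rfl⟩, -⟩
    have hd : 0 < d := Nat.pos_of_mul_pos_right hm
    refine ⟨⟨⟨2 * e, by ring⟩, by positivity⟩, ?_⟩
    rw [mul_left_comm, Nat.mul_div_cancel_left _ hd]
    exact even_two_mul e

lemma sigma_three_of_odd {n : ℕ} (hn : Odd n) : σ 3 n = sigmaStar3 n := by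
  rw [ArithmeticFunction.sigma_apply, sigmaStar3, Finset.filter_true_of_mem]
  intro d hd
  exact hn.of_dvd_nat (Nat.div_dvd_of_dvd (Nat.dvd_of_mem_divisors hd))

lemma summable_sigma_three_mul_qexp_pow (z : ℍ) :
    Summable fun n : ℕ => (σ 3 n : ℂ) * qexp z ^ n :=
  EisensteinSeries.summable_sigma_mul_cexp_pow (k := 4) (by norm_num) z

lemma E₄_eq_tsum (z : ℍ) : E₄ z = 1 + 240 * ∑' n : ℕ, (σ 3 n : ℂ) * qexp z ^ n := by
  have hb : bernoulli 4 = -1 / 30 := by decide +kernel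
  have h := EisensteinSeries.q_expansion_bernoulli (k := 4) (by norm_num) ⟨2, rfl⟩ z
  simp only [zpow_natCast, hb] at h
  rw [← tsum_pnat_eq_tsum_of_eq_zero (f := fun n => (σ 3 n : ℂ) * qexp z ^ n) (by simp)]
  refine h.trans ?_
  simp only [qexp]
  push_cast
  ring

lemma Einf4_eq (z : ℍ) : Einf4 z = (E₄ z - E₄ (dilateTwo z)) / 240 := by
  have h1 := (summable_sigma_three_mul_qexp_pow z).hasSum
  have h2 := (summable_sigma_three_mul_qexp_pow (dilateTwo z)).hasSum
  let b (n : ℕ) : ℂ := if Even n then (σ 3 (n / 2) : ℂ) * qexp z ^ n else 0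
  have hb : HasSum b (∑' n : ℕ, (σ 3 n : ℂ) * qexp (dilateTwo z) ^ n) := by
    rw [← (mul_right_injective₀ (two_ne_zero' ℕ)).hasSum_iff]
    · convert h2 using 2 with n
      simp [b, qexp_dilateTwo, pow_mul]
    · intro n hn
      refine if_neg fun ⟨k, hk⟩ => hn ⟨k, ?_⟩
      simp only
      omega
  have hab (n : ℕ) : (sigmaStar3 n : ℂ) * qexp z ^ n = (σ 3 n : ℂ) * qexp z ^ n - b n := by
    obtain ⟨m, rfl⟩ | hn := n.even_or_odd
    · simp only [b, ← two_mul]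
      simp [sigma_three_two_mul]
      ring
    · simp [b, Nat.not_even_iff_odd.2 hn, sigma_three_of_odd hn]
  rw [Einf4, tsum_pnat_eq_tsum_of_eq_zero (f := fun n => (sigmaStar3 n : ℂ) * qexp z ^ n)
      (by simp [sigmaStar3]),
    tsum_congr hab, (h1.sub hb).tsum_eq, E₄_eq_tsum, E₄_eq_tsum]
  ring

lemma dedekindEta_eq_eta : dedekindEta = ModularForm.eta := by
  ext z
  rw [dedekindEta, ModularForm.eta, tprod_pnat_eq_tprod_succ (f := fun n => 1 - qexp z ^ n)]
  simp only [eta_q, ← qexp_eq_qParam]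
  congr 2
  push_cast
  ring

lemma multipliable_one_sub_pow_odd {q : ℂ} (hq : ‖q‖ < 1) :
    Multipliable fun n : ℕ => 1 - q ^ (2 * n + 1) := by
  simp only [sub_eq_add_neg]
  refine multipliable_one_add_of_summable ?_
  have := (summable_geometric_of_lt_one (norm_nonneg _) hq).comp_injective
    (i := fun n : ℕ => 2 * n + 1) fun a b h => by simpa using h
  simpa [Function.comp_def] using this

lemma eulerProd_sq_mul_tprod_odd {q : ℂ} (hq : ‖q‖ < 1) :
    eulerProd (q ^ 2) * ∏' n : ℕ, (1 - q ^ (2 * n + 1)) = eulerProd q := by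
  have he : Multipliable fun n : ℕ => 1 - q ^ (2 * n + 1 + 1) := by
    convert multipliable_one_sub_pow (q := q ^ 2)
      (by simpa using pow_lt_one₀ (norm_nonneg q) hq two_ne_zero) using 3
    ring
  have h : eulerProd (q ^ 2) = ∏' n : ℕ, (1 - q ^ (2 * n + 1 + 1)) :=
    tprod_congr fun n => by ring
  rw [h, mul_comm]
  exact tprod_even_mul_odd (f := fun n => 1 - q ^ (n + 1)) (multipliable_one_sub_pow_odd hq) he

lemma eta_quotient_eq_tprod (z : ℍ) : ModularForm.eta (2 * z) ^ 16 / ModularForm.eta z ^ 8 =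
    qexp z * (∏' n : ℕ+, (1 - qexp z ^ (2 * (n : ℕ))) ^ 8) *
      ∏' n : ℕ+, ((1 - qexp z ^ (2 * (n : ℕ) - 1)) ^ 8)⁻¹ := by
  have hq := norm_qexp_lt_one z
  have he : eulerProd (qexp z) ≠ 0 := eulerProd_ne_zero z
  have hsplit := eulerProd_sq_mul_tprod_odd hq
  rw [← hsplit, mul_ne_zero_iff] at he
  have hm := multipliable_one_sub_pow_odd hq
  have h1 : ∏' n : ℕ+, (1 - qexp z ^ (2 * (n : ℕ))) ^ 8 = eulerProd (qexp z ^ 2) ^ 8 := by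
    rw [tprod_pnat_eq_tprod_succ (f := fun n => (1 - qexp z ^ (2 * n)) ^ 8)]
    simp only [pow_mul (qexp z)]
    exact (multipliable_one_sub_pow
      (by simpa using pow_lt_one₀ (norm_nonneg _) hq two_ne_zero)).tprod_pow 8
  have h2 : ∏' n : ℕ+, ((1 - qexp z ^ (2 * (n : ℕ) - 1)) ^ 8)⁻¹ =
      ((∏' n : ℕ, (1 - qexp z ^ (2 * n + 1))) ^ 8)⁻¹ := by
    rw [tprod_pnat_eq_tprod_succ (f := fun n => ((1 - qexp z ^ (2 * n - 1)) ^ 8)⁻¹)]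
    exact ((hm.hasProd.pow 8).inv₀ (pow_ne_zero 8 he.2)).tprod_eq
  rw [eta_quotient_eq, h1, h2, ← hsplit]
  obtain ⟨hA, hB⟩ := he
  field_simp

/-- Proposition 2.3: `E_{∞,4}(z) = η(2z)¹⁶ η(z)⁻⁸`, and consequently `E_{∞,4}` has the
product expansion `q · Π_{n even} (1−qⁿ)⁸ · Π_{n odd} (1−qⁿ)⁻⁸`. -/
theorem stmt6 (z : ℍ) :
    Einf4 (z : ℂ) = dedekindEta (2 * (z : ℂ)) ^ 16 / dedekindEta (z : ℂ) ^ 8 ∧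
    Einf4 (z : ℂ) =
      qexp (z : ℂ) * (∏' n : ℕ+, (1 - qexp (z : ℂ) ^ (2 * (n : ℕ))) ^ 8) *
        ∏' n : ℕ+, ((1 - qexp (z : ℂ) ^ (2 * (n : ℕ) - 1)) ^ 8)⁻¹ := by
  have h : Einf4 z = ModularForm.eta (2 * z) ^ 16 / ModularForm.eta z ^ 8 := by
    rw [Einf4_eq, E₄_sub_E₄_dilateTwo, mul_div_cancel_left₀ _ (by norm_num)]
  exact ⟨by rw [h, dedekindEta_eq_eta], h.trans (eta_quotient_eq_tprod z)⟩

end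
end
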